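/- Fix an integer r ≥ 1 and let s, B, b_0,…,b_{2r+1}, g_k be as defined. Then gcd(b_1 b_2 ⋯ b_{2r+1}, g_0) = 1 and gcd(b_1 b_2 ⋯ b_{2r}, g_1) = 1. (In the paper's notation: the weight c_0 and the weight m_n of the irreducible divisor S are relatively prime, for n = 2r+1 and n = 2r respectively; this is the key step in showing the hypersurface X of Theorem 6.1 is well-formed.) -/

import Mathlib

/-- Sylvester's sequence: `s 0 = 2`, `s (j+1) = s j * (s j − 1) + 1`;
it begins 2, 3, 7, 43, 1807, …. -/
def sylv : ℕ → ℕ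
  | 0 => 2
  | n + 1 => sylv n * (sylv n - 1) + 1

/-- The alternating sum `B(x₁,…,x_k) = ∑_{j=0}^{k} (−1)^{k−j} x₁⋯x_j`
(the empty product being 1), characterized by `B [] = 1` and
`B (x :: xs) = x * B xs + (−1)^(length (x :: xs))`. -/
def Bsum : List ℤ → ℤ
  | [] => 1
  | x :: xs => x * Bsum xs + (-1) ^ (xs.length + 1)

/-- `Zl r t` is the list of length `2t` formed by concatenating the pairs
`(b_{r+u}, b_{r+1−u})` for `u = 1, …, t`, where `b` are the exponents
defined inductively together with this list. -/
def Zl (r : ℕ) : ℕ → List ℤ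
  | 0 => []
  | t + 1 => Zl r t ++ [1 + ((sylv (r - t) : ℤ) - 1) ^ 2 * Bsum (Zl r t), (sylv (r - t) : ℤ)]

/-- The exponents `b_0, …, b_{2r+1}`: `b_j = s_j` for `j ≤ r`, and
`b_{r+i} = 1 + (b_{r+1−i} − 1)² · B(Z_{i−1})` for `1 ≤ i ≤ r+1`
(here, for `j = r + i`, one has `b_{r+1−i} = s_{2r+1−j}`). -/
def bexp (r j : ℕ) : ℤ :=
  if j ≤ r then (sylv j : ℤ)
  else 1 + ((sylv (2 * r + 1 - j) : ℤ) - 1) ^ 2 * Bsum (Zl r (j - r - 1))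

/-- The list `L_k = (b_{r+1}, b_r, b_{r+2}, b_{r−1}, …, b_{2r+1−k}, b_k)`,
formed by concatenating the pairs `(b_{r+t}, b_{r+1−t})` for `t = 1, …, r+1−k`. -/
def Lk (r k : ℕ) : List ℤ := Zl r (r + 1 - k)

/-- `t_k := B(L_k)`. -/
def tB (r k : ℕ) : ℤ := Bsum (Lk r k)

/-- `g_k := B(reverse of L_k)`. -/
def gB (r k : ℕ) : ℤ := Bsum (Lk r k).reverse

/-- `T_k`: the alternating sum of `B` over the suffixes of `L_k`
(the full list with sign `+`, the empty suffix contributing `+1`). -/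
def TB (r k : ℕ) : ℤ :=
  ∑ m ∈ Finset.range ((Lk r k).length + 1), (-1) ^ m * Bsum ((Lk r k).drop m)

/-- `w_k := (s_k − 1)·T_k − 1`. -/
def wB (r k : ℕ) : ℤ := ((sylv k : ℤ) - 1) * TB r k - 1

theorem sylv_pos (n : ℕ) : 1 ≤ sylv n := by
  cases n <;> simp [sylv]

theorem sylv_succ_sub_one (n : ℕ) :
    (sylv (n + 1) : ℤ) - 1 = ((sylv n : ℤ) - 1) * sylv n := by
  rw [sylv]
  push_cast [Nat.cast_sub (sylv_pos n)]
  ring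

theorem Bsum_concat (L : List ℤ) (x : ℤ) : Bsum (L ++ [x]) = L.prod * x - Bsum L := by
  induction L with
  | nil => simp [Bsum]; ring
  | cons y L ih =>
    simp only [List.cons_append, Bsum, ih, List.prod_cons, List.length_append,
      List.length_singleton]
    ring

theorem length_Zl (r t : ℕ) : (Zl r t).length = 2 * t := by
  induction t with
  | zero => rfl
  | succ t ih => simp [Zl, ih, mul_add]

theorem Bsum_Zl_succ (r t : ℕ) :
    Bsum (Zl r (t + 1)) =
      (Zl r t).prod * (1 + ((sylv (r - t) : ℤ) - 1) ^ 2 * Bsum (Zl r t)) *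
        ((sylv (r - t) : ℤ) - 1) + Bsum (Zl r t) := by
  rw [Zl, List.append_cons, Bsum_concat, Bsum_concat]
  simp only [List.prod_append, List.prod_singleton]
  ring

theorem Bsum_reverse_Zl_succ (r t : ℕ) :
    Bsum (Zl r (t + 1)).reverse =
      (sylv (r - t) : ℤ) * (1 + ((sylv (r - t) : ℤ) - 1) ^ 2 * Bsum (Zl r t)) *
        Bsum (Zl r t).reverse - ((sylv (r - t) : ℤ) - 1) := by
  rw [Zl]
  simp [Bsum, length_Zl, pow_add, pow_mul]
  ring

theorem prod_Zl_succ (r t : ℕ) :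
    (Zl r (t + 1)).prod =
      (Zl r t).prod * (1 + ((sylv (r - t) : ℤ) - 1) ^ 2 * Bsum (Zl r t)) * sylv (r - t) := by
  simp [Zl, mul_assoc]

theorem sylv_sub_one_step {r t : ℕ} (ht : t ≤ r) :
    (sylv (r + 1 - t) : ℤ) - 1 = ((sylv (r - t) : ℤ) - 1) * sylv (r - t) := by
  rw [Nat.sub_add_comm ht, sylv_succ_sub_one]

/-- `(Zl r t).prod` and `Bsum (Zl r t)` are both `1` modulo `s_{r+1-t} - 1`. -/
theorem sylv_sub_one_dvd {r t : ℕ} (ht : t ≤ r + 1) :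
    (sylv (r + 1 - t) : ℤ) - 1 ∣ (Zl r t).prod - 1 ∧
      (sylv (r + 1 - t) : ℤ) - 1 ∣ Bsum (Zl r t) - 1 := by
  induction t with
  | zero => simp [Zl, Bsum]
  | succ t ih =>
    obtain ⟨⟨m, hm⟩, ⟨n, hn⟩⟩ := ih (by omega)
    rw [sylv_sub_one_step (by omega)] at hm hn
    rw [prod_Zl_succ, Bsum_Zl_succ, Nat.add_sub_add_right]
    generalize (sylv (r - t) : ℤ) = a at *
    generalize (Zl r t).prod = P at *
    generalize Bsum (Zl r t) = B at *
    constructor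
    · exact ⟨a * m * ((1 + (a - 1) ^ 2 * B) * a) + (a - 1) * B * a + 1, by
        linear_combination ((1 + (a - 1) ^ 2 * B) * a) * hm⟩
    · exact ⟨P * (1 + (a - 1) ^ 2 * B) + a * n, by linear_combination hn⟩

/-- Every entry of `Zl r t` divides `(s_{r+1-t} - 1) * B(Zl r t) * B(reverse (Zl r t)) - 1`. -/
theorem dvd_of_mem_Zl {r t : ℕ} (ht : t ≤ r + 1) {x : ℤ} (hx : x ∈ Zl r t) :
    x ∣ ((sylv (r + 1 - t) : ℤ) - 1) * Bsum (Zl r t) * Bsum (Zl r t).reverse - 1 := by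
  induction t with
  | zero => simp [Zl] at hx
  | succ t ih =>
    replace ih := ih (by omega)
    obtain ⟨⟨m, hm⟩, ⟨n, hn⟩⟩ := sylv_sub_one_dvd (r := r) (t := t) (by omega)
    have hP : x ∈ Zl r t → x ∣ (Zl r t).prod := List.dvd_prod
    rw [sylv_sub_one_step (by omega)] at hm hn ih
    rw [Bsum_reverse_Zl_succ, Bsum_Zl_succ, Nat.add_sub_add_right]
    simp only [Zl, List.mem_append, List.mem_cons, List.not_mem_nil, or_false] at hx
    generalize (sylv (r - t) : ℤ) = a at *
    generalize (Zl r t).prod = P at *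
    generalize Bsum (Zl r t).reverse = g at *
    generalize Bsum (Zl r t) = B at *
    have key : (a - 1) * (P * (1 + (a - 1) ^ 2 * B) * (a - 1) + B) *
        (a * (1 + (a - 1) ^ 2 * B) * g - (a - 1)) - 1 =
        (1 + (a - 1) ^ 2 * B) * (P * ((a - 1) ^ 2 *
          (a * (1 + (a - 1) ^ 2 * B) * g - (a - 1))) + ((a - 1) * a * B * g - 1)) := by
      ring
    rcases hx with hx | rfl | rfl
    · rw [key]
      exact (dvd_add ((hP hx).mul_right _) (ih hx)).mul_left _
    · rw [key]
      exact dvd_mul_right _ _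
    · have hP1 : P ≡ 1 [ZMOD x] := (Int.modEq_iff_dvd.2 ⟨(x - 1) * m, by rw [hm]; ring⟩).symm
      have hB1 : B ≡ 1 [ZMOD x] := (Int.modEq_iff_dvd.2 ⟨(x - 1) * n, by rw [hn]; ring⟩).symm
      have hx0 : x ≡ 0 [ZMOD x] := by simp [Int.ModEq]
      have h : (x - 1) * (P * (1 + (x - 1) ^ 2 * B) * (x - 1) + B) *
          (x * (1 + (x - 1) ^ 2 * B) * g - (x - 1)) - 1 ≡
          (0 - 1) * (1 * (1 + (0 - 1) ^ 2 * 1) * (0 - 1) + 1) *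
          (0 * (1 + (0 - 1) ^ 2 * 1) * g - (0 - 1)) - 1 [ZMOD x] := by
        gcongr
      exact Int.modEq_zero_iff_dvd.1 (h.trans (by ring_nf; rfl))

theorem pair_mem_Zl {r i t : ℕ} (h : i < t) :
    1 + ((sylv (r - i) : ℤ) - 1) ^ 2 * Bsum (Zl r i) ∈ Zl r t ∧ (sylv (r - i) : ℤ) ∈ Zl r t := by
  induction t with
  | zero => omega
  | succ t ih =>
    rcases Nat.lt_succ_iff_lt_or_eq.1 h with h | rfl
    · exact ⟨List.mem_append_left _ (ih h).1, List.mem_append_left _ (ih h).2⟩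
    · simp [Zl]

theorem bexp_mem_Zl {r t j : ℕ} (h₁ : r < j + t) (h₂ : j ≤ r + t) : bexp r j ∈ Zl r t := by
  unfold bexp
  split_ifs with h
  · have := (pair_mem_Zl (r := r) (i := r - j) (t := t) (by omega)).2
    rwa [Nat.sub_sub_self h] at this
  · have := (pair_mem_Zl (r := r) (i := j - r - 1) (t := t) (by omega)).1
    rwa [show r - (j - r - 1) = 2 * r + 1 - j by omega] at this

theorem isCoprime_of_mem_Zl {r t : ℕ} (ht : t ≤ r + 1) {x : ℤ} (hx : x ∈ Zl r t) :
    IsCoprime x (Bsum (Zl r t).reverse) := by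
  obtain ⟨k, hk⟩ := dvd_of_mem_Zl ht hx
  exact ⟨-k, ((sylv (r + 1 - t) : ℤ) - 1) * Bsum (Zl r t), by linear_combination hk⟩

/-- The coprimality statements behind well-formedness in Theorem 6.1 of Esser–Totaro:
`gcd(b_1 ⋯ b_{2r+1}, m_{2r+1}) = 1` and `gcd(b_1 ⋯ b_{2r}, m_{2r}) = 1`,
where `m_{2r+1} = g_0` and `m_{2r} = g_1`. -/
theorem weight_coprimality (r : ℕ) (hr : 1 ≤ r) :
    Int.gcd (∏ j ∈ Finset.Icc 1 (2 * r + 1), bexp r j) (gB r 0) = 1 ∧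
    Int.gcd (∏ j ∈ Finset.Icc 1 (2 * r), bexp r j) (gB r 1) = 1 := by
  simp only [gB, Lk, ← Int.isCoprime_iff_gcd_eq_one]
  refine ⟨IsCoprime.prod_left fun j hj => ?_, IsCoprime.prod_left fun j hj => ?_⟩ <;>
  · rw [Finset.mem_Icc] at hj
    exact isCoprime_of_mem_Zl (by omega) (bexp_mem_Zl (by omega) (by omega))
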